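/- Let K be a field, G a semigroup, and let A and B be K-algebras endowed with finite G-gradings (the supports {g : A_g ≠ 0} and {g : B_g ≠ 0} are finite). Then A and B satisfy the same G-graded polynomial identities if and only if A and B satisfy the same Ω_G-polynomial identities, where an Ω_G-polynomial is a finitely supported K-linear combination f = ∑_t c_t · t of terms t built from the variables X using one binary function symbol μ and a unary function symbol π_g for each g ∈ G, and f is an Ω_G-polynomial identity of A if for every map v : X → A one has ∑_t c_t · t^A(v) = 0, where t^A(v) denotes the realization of the term t in A interpreting μ as the multiplication of A and each symbol π_g as the projection of A onto A_g. -/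

import Mathlib

/-!
STATEMENT 7: Let K be a field, G a semigroup, and A, B K-algebras with finite G-gradings.
Then A and B satisfy the same G-graded polynomial identities iff A and B satisfy the same
Ω_G-polynomial identities, where Ω_G consists of one binary function symbol μ and a unary
function symbol π_g for each g ∈ G, an Ω_G-polynomial is a finitely supported K-linear
combination of Ω_G-terms in the variables X, and in an algebra μ is interpreted as the
multiplication and π_g as the projection onto the homogeneous component of degree g.
-/

/-- Terms over the signature `Ω_G = {μ} ∪ {π_g : g ∈ G}` in the variables `X = ℕ`. -/
inductive OmegaTerm (G : Type*) where
  | var : ℕ → OmegaTerm G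
  | pi : G → OmegaTerm G → OmegaTerm G
  | mu : OmegaTerm G → OmegaTerm G → OmegaTerm G

/-- The realization `t^A(v)` of an `Ω_G`-term `t` in the `G`-graded algebra `A` under the
evaluation `v` of the variables, interpreting `μ` as the multiplication of `A` and each `π_g`
as the projection of `A` onto `A_g`. -/
noncomputable def OmegaTerm.eval {K G A : Type*} [Field K] [DecidableEq G]
    [NonUnitalNonAssocRing A] [Module K A]
    (𝒜 : G → Submodule K A) [DirectSum.Decomposition 𝒜] (v : ℕ → A) :
    OmegaTerm G → A
  | var n => v n
  | pi g t => (DirectSum.decompose 𝒜 (t.eval 𝒜 v) g : A)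
  | mu s t => s.eval 𝒜 v * t.eval 𝒜 v

/-- `f`, a finitely supported `K`-linear combination of `Ω_G`-terms, is an
`Ω_G`-polynomial identity of `A`. -/
noncomputable def IsOmegaPI {K G A : Type*} [Field K] [DecidableEq G]
    [NonUnitalNonAssocRing A] [Module K A]
    (𝒜 : G → Submodule K A) [DirectSum.Decomposition 𝒜] (f : OmegaTerm G →₀ K) : Prop :=
  ∀ v : ℕ → A, (f.sum fun t c => c • OmegaTerm.eval 𝒜 v t) = 0

/-- `f`, an element of the free nonassociative `G`-graded algebra `K⟨X^G⟩` (with `X = ℕ`,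
realized as the free non-unital non-associative algebra on `ℕ × G`, where `(x, g)` plays the
role of the generator `x^{(g)}`), is a `G`-graded polynomial identity of `A`. -/
def IsGradedPI {K G A : Type*} [Field K] [NonUnitalNonAssocRing A] [Module K A]
    [SMulCommClass K A A] [IsScalarTower K A A]
    (𝒜 : G → Submodule K A) (f : FreeNonUnitalNonAssocAlgebra K (ℕ × G)) : Prop :=
  ∀ e : ℕ × G → A, (∀ x g, e (x, g) ∈ 𝒜 g) →
    FreeNonUnitalNonAssocAlgebra.lift K e f = 0

open DirectSum

/-- The `Ω_G`-term obtained from a graded monomial by writing `π_g(x)` for each `x^{(g)}`. -/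
def FreeMagma.toOmegaTerm {G : Type*} : FreeMagma (ℕ × G) → OmegaTerm G
  | .of p => .pi p.2 (.var p.1)
  | .mul s t => .mu s.toOmegaTerm t.toOmegaTerm

/-- The degree of a graded monomial. -/
def FreeMagma.gradedDegree {G : Type*} [Mul G] : FreeMagma (ℕ × G) →ₙ* G :=
  FreeMagma.lift Prod.snd

/-- The projection of the free graded algebra onto its component of degree `g`. -/
def FreeNonUnitalNonAssocAlgebra.gradedProj {K G : Type*} [Field K] [Mul G] [DecidableEq G]
    (g : G) (f : FreeNonUnitalNonAssocAlgebra K (ℕ × G)) :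
    FreeNonUnitalNonAssocAlgebra K (ℕ × G) :=
  .ofCoeff (f.coeff.filter fun m => m.gradedDegree = g)

/-- The realization of an `Ω_G`-term in the free graded algebra, each variable `x` being sent
to `∑ g ∈ S, x^{(g)}`. -/
noncomputable def OmegaTerm.toFree (K : Type*) {G : Type*} [Field K] [Mul G] [DecidableEq G]
    (S : Finset G) : OmegaTerm G → FreeNonUnitalNonAssocAlgebra K (ℕ × G)
  | var n => ∑ g ∈ S, FreeNonUnitalNonAssocAlgebra.of K (n, g)
  | pi g t => FreeNonUnitalNonAssocAlgebra.gradedProj g (t.toFree K S)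
  | mu s t => s.toFree K S * t.toFree K S

theorem FreeNonUnitalNonAssocAlgebra.lift_single {K X A : Type*} [Field K]
    [NonUnitalNonAssocRing A] [Module K A] [SMulCommClass K A A] [IsScalarTower K A A]
    (e : X → A) (m : FreeMagma X) (c : K) :
    lift K e (MonoidAlgebra.single m c) = c • FreeMagma.lift e m := by
  simp [lift, MonoidAlgebra.liftMagma]

theorem FreeMagma.lift_mem_gradedDegree {K G A : Type*} [Field K] [Mul G]
    [NonUnitalNonAssocRing A] [Module K A] (𝒜 : G → Submodule K A)
    (hgr : ∀ g h : G, ∀ a ∈ 𝒜 g, ∀ b ∈ 𝒜 h, a * b ∈ 𝒜 (g * h))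
    {e : ℕ × G → A} (he : ∀ x g, e (x, g) ∈ 𝒜 g) (m : FreeMagma (ℕ × G)) :
    FreeMagma.lift e m ∈ 𝒜 m.gradedDegree := by
  induction m with
  | ih1 p => exact he p.1 p.2
  | ih2 s t hs ht =>
    rw [map_mul, map_mul]
    exact hgr _ _ _ hs _ ht

section Graded

variable {K G A : Type*} [Field K] [DecidableEq G] [NonUnitalNonAssocRing A] [Module K A]
  (𝒜 : G → Submodule K A) [Decomposition 𝒜]

theorem OmegaTerm.eval_toOmegaTerm (v : ℕ → A) (m : FreeMagma (ℕ × G)) :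
    m.toOmegaTerm.eval 𝒜 v =
      FreeMagma.lift (fun p : ℕ × G => (decompose 𝒜 (v p.1) p.2 : A)) m := by
  induction m with
  | ih1 p => rfl
  | ih2 s t hs ht =>
    rw [map_mul, ← hs, ← ht]
    rfl

theorem sum_decompose_of_support_subset {S : Finset G} (hS : ∀ g, 𝒜 g ≠ ⊥ → g ∈ S) (a : A) :
    ∑ g ∈ S, (decompose 𝒜 a g : A) = a := by
  classical
  conv_rhs => rw [← sum_support_decompose 𝒜 a]
  symm
  refine Finset.sum_subset (fun g hg => hS g fun h => ?_) fun g _ hg => by simpa using hg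
  have h' : (decompose 𝒜 a g : A) ∈ 𝒜 g := (decompose 𝒜 a g).2
  simp only [h, Submodule.mem_bot] at h'
  exact DFinsupp.mem_support_iff.mp hg (Subtype.ext h')

theorem decompose_sum_homogeneous {S : Finset G} (hS : ∀ g, 𝒜 g ≠ ⊥ → g ∈ S) {a : G → A}
    (ha : ∀ g, a g ∈ 𝒜 g) (g : G) : (decompose 𝒜 (∑ h ∈ S, a h) g : A) = a g := by
  rw [decompose_sum, DFinsupp.finsetSum_apply, AddSubmonoidClass.coe_finsetSum,
    Finset.sum_eq_single g]
  · exact decompose_of_mem_same 𝒜 (ha g)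
  · exact fun h _ hne => decompose_of_mem_ne 𝒜 (ha h) hne
  · intro hg
    have h0 : 𝒜 g = ⊥ := by
      by_contra h
      exact hg (hS g h)
    have := ha g
    rw [h0, Submodule.mem_bot] at this
    simp [this]

variable [SMulCommClass K A A] [IsScalarTower K A A]

theorem FreeNonUnitalNonAssocAlgebra.lift_gradedProj [Mul G]
    (hgr : ∀ g h : G, ∀ a ∈ 𝒜 g, ∀ b ∈ 𝒜 h, a * b ∈ 𝒜 (g * h))
    {e : ℕ × G → A} (he : ∀ x g, e (x, g) ∈ 𝒜 g) (g : G)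
    (f : FreeNonUnitalNonAssocAlgebra K (ℕ × G)) :
    lift K e (gradedProj g f) = decompose 𝒜 (lift K e f) g := by
  induction f using MonoidAlgebra.induction_linear with
  | zero =>
    have h0 : gradedProj g (0 : FreeNonUnitalNonAssocAlgebra K (ℕ × G)) = 0 := by
      simp only [gradedProj, MonoidAlgebra.coeff_zero, Finsupp.filter_zero,
        MonoidAlgebra.ofCoeff_zero]
    simp [h0]
  | add f f' hf hf' =>
    rw [map_add, decompose_add, DirectSum.add_apply, Submodule.coe_add, ← hf, ← hf', ← map_add]
    simp [gradedProj, Finsupp.filter_add]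
  | single m c =>
    have hm := FreeMagma.lift_mem_gradedDegree 𝒜 hgr he m
    rw [lift_single]
    have hm' := (𝒜 m.gradedDegree).smul_mem c hm
    by_cases h : m.gradedDegree = g
    · subst h
      rw [decompose_of_mem_same 𝒜 hm']
      simp [gradedProj, lift_single]
    · rw [decompose_of_mem_ne 𝒜 hm' h]
      simp [gradedProj, h]

theorem OmegaTerm.lift_toFree [Mul G]
    (hgr : ∀ g h : G, ∀ a ∈ 𝒜 g, ∀ b ∈ 𝒜 h, a * b ∈ 𝒜 (g * h))
    {e : ℕ × G → A} (he : ∀ x g, e (x, g) ∈ 𝒜 g) (S : Finset G) (t : OmegaTerm G) :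
    FreeNonUnitalNonAssocAlgebra.lift K e (t.toFree K S) =
      t.eval 𝒜 fun x => ∑ g ∈ S, e (x, g) := by
  induction t with
  | var n => simp [toFree, eval]
  | pi g t ih =>
    rw [toFree, FreeNonUnitalNonAssocAlgebra.lift_gradedProj 𝒜 hgr he, ih, eval]
  | mu s t hs ht => rw [toFree, map_mul, hs, ht, eval]

theorem isGradedPI_iff_isOmegaPI {S : Finset G} (hS : ∀ g, 𝒜 g ≠ ⊥ → g ∈ S)
    (f : FreeNonUnitalNonAssocAlgebra K (ℕ × G)) :
    IsGradedPI 𝒜 f ↔ IsOmegaPI 𝒜 (f.coeff.mapDomain FreeMagma.toOmegaTerm) := by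
  have key : ∀ v : ℕ → A, ((f.coeff.mapDomain FreeMagma.toOmegaTerm).sum
      fun t c => c • OmegaTerm.eval 𝒜 v t) = FreeNonUnitalNonAssocAlgebra.lift K
        (fun p : ℕ × G => (decompose 𝒜 (v p.1) p.2 : A)) f := by
    intro v
    rw [Finsupp.sum_mapDomain_index (by simp) (by simp [add_smul])]
    simp only [OmegaTerm.eval_toOmegaTerm]
    simp only [FreeNonUnitalNonAssocAlgebra.lift, MonoidAlgebra.liftMagma]
    rfl
  refine ⟨fun h v => (key v).trans (h _ fun x g => (decompose 𝒜 (v x) g).2), fun h e he => ?_⟩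
  have hv := (key fun x => ∑ g ∈ S, e (x, g)).symm.trans (h _)
  simpa only [decompose_sum_homogeneous 𝒜 hS (he _)] using hv

theorem isOmegaPI_iff_isGradedPI [Mul G]
    (hgr : ∀ g h : G, ∀ a ∈ 𝒜 g, ∀ b ∈ 𝒜 h, a * b ∈ 𝒜 (g * h))
    {S : Finset G} (hS : ∀ g, 𝒜 g ≠ ⊥ → g ∈ S) (f : OmegaTerm G →₀ K) :
    IsOmegaPI 𝒜 f ↔ IsGradedPI 𝒜 (f.sum fun t c => c • t.toFree K S) := by
  have key : ∀ e : ℕ × G → A, (∀ x g, e (x, g) ∈ 𝒜 g) →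
      FreeNonUnitalNonAssocAlgebra.lift K e (f.sum fun t c => c • t.toFree K S) =
        f.sum fun t c => c • t.eval 𝒜 fun x => ∑ g ∈ S, e (x, g) := by
    intro e he
    simp only [Finsupp.sum, map_sum, map_smul, OmegaTerm.lift_toFree 𝒜 hgr he]
  refine ⟨fun h e he => (key e he).trans (h _), fun h v => ?_⟩
  have he : ∀ x g, (decompose 𝒜 (v x) g : A) ∈ 𝒜 g := fun x g => (decompose 𝒜 (v x) g).2
  have hv := (key (fun p => (decompose 𝒜 (v p.1) p.2 : A)) he).symm.trans (h _ he)
  simpa only [sum_decompose_of_support_subset 𝒜 hS] using hv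

end Graded

theorem same_graded_identities_iff_same_omega_identities
    (K G A B : Type*) [Field K] [Semigroup G] [DecidableEq G]
    [NonUnitalNonAssocRing A] [Module K A] [SMulCommClass K A A] [IsScalarTower K A A]
    [NonUnitalNonAssocRing B] [Module K B] [SMulCommClass K B B] [IsScalarTower K B B]
    (𝒜 : G → Submodule K A) [DirectSum.Decomposition 𝒜]
    (hgrA : ∀ (g h : G), ∀ a ∈ 𝒜 g, ∀ b ∈ 𝒜 h, a * b ∈ 𝒜 (g * h))
    (ℬ : G → Submodule K B) [DirectSum.Decomposition ℬ]
    (hgrB : ∀ (g h : G), ∀ a ∈ ℬ g, ∀ b ∈ ℬ h, a * b ∈ ℬ (g * h))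
    (hfinA : {g : G | 𝒜 g ≠ ⊥}.Finite) (hfinB : {g : G | ℬ g ≠ ⊥}.Finite) :
    (∀ f : FreeNonUnitalNonAssocAlgebra K (ℕ × G), IsGradedPI 𝒜 f ↔ IsGradedPI ℬ f) ↔
      (∀ f : OmegaTerm G →₀ K, IsOmegaPI 𝒜 f ↔ IsOmegaPI ℬ f) := by
  have hSA : ∀ g, 𝒜 g ≠ ⊥ → g ∈ hfinA.toFinset ∪ hfinB.toFinset := by
    intro g hg
    simp [hg]
  have hSB : ∀ g, ℬ g ≠ ⊥ → g ∈ hfinA.toFinset ∪ hfinB.toFinset := by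
    intro g hg
    simp [hg]
  refine ⟨fun h f => ?_, fun h f => ?_⟩
  · rw [isOmegaPI_iff_isGradedPI 𝒜 hgrA hSA, isOmegaPI_iff_isGradedPI ℬ hgrB hSB, h]
  · rw [isGradedPI_iff_isOmegaPI 𝒜 hSA, isGradedPI_iff_isOmegaPI ℬ hSB, h]
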